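/- arXiv:2405.07793 — 6 statements merged into one kernel-verified Lean document; each statement's English description precedes it below -/
import Mathlib

section
/- Every element x of 𝕃 = 𝕃(2,2,n) can be written in normal form x = l₁·x₁ + l₂·x₂ + l₃·x₃ + l·c with integers l₁, l₂, l₃, l satisfying 0 ≤ l₁ < 2, 0 ≤ l₂ < 2 and 0 ≤ l₃ < n, and the integers l₁, l₂, l₃, l in such a representation are uniquely determined by x. -/
/-- The relation subgroup of `ℤ³` defining `𝕃(2,2,n)`: generated by `(2,-2,0)` and `(2,0,-n)`. -/
def Lrel (n : ℤ) : AddSubgroup (ℤ × ℤ × ℤ) :=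
  AddSubgroup.closure {(2, -2, 0), (2, 0, -n)}

/-- The Picard group `𝕃 = 𝕃(2,2,n)`. -/
abbrev Lgrp (n : ℤ) := (ℤ × ℤ × ℤ) ⧸ Lrel n

/-- The image in `𝕃` of a vector of `ℤ³`; the generators are
`x₁ = xgen n (1,0,0)`, `x₂ = xgen n (0,1,0)`, `x₃ = xgen n (0,0,1)`. -/
def xgen (n : ℤ) (v : ℤ × ℤ × ℤ) : Lgrp n := QuotientAddGroup.mk v

theorem mem_Lrel_iff (n a b c : ℤ) :
    (a, b, c) ∈ Lrel n ↔ ∃ s t : ℤ, a = 2 * s + 2 * t ∧ b = -(2 * s) ∧ c = -(n * t) := by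
  rw [Lrel, AddSubgroup.mem_closure_pair]
  refine exists_congr fun s => exists_congr fun t => ?_
  simp only [Prod.smul_mk, Prod.mk_add_mk, Prod.mk.injEq, smul_eq_mul]
  constructor <;> rintro ⟨h₁, h₂, h₃⟩ <;> refine ⟨?_, ?_, ?_⟩ <;> linarith

theorem xgen_eq_normal_form_iff (n a b c l₁ l₂ l₃ l : ℤ) :
    xgen n (a, b, c) = l₁ • xgen n (1, 0, 0) + l₂ • xgen n (0, 1, 0) + l₃ • xgen n (0, 0, 1)
        + l • ((2 : ℤ) • xgen n (1, 0, 0)) ↔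
      ∃ s t : ℤ, l₁ + 2 * l - a = 2 * s + 2 * t ∧ l₂ - b = -(2 * s) ∧ l₃ - c = -(n * t) := by
  have h : l₁ • xgen n (1, 0, 0) + l₂ • xgen n (0, 1, 0) + l₃ • xgen n (0, 0, 1)
      + l • ((2 : ℤ) • xgen n (1, 0, 0)) = xgen n (l₁ + 2 * l, l₂, l₃) := by
    simp only [xgen, ← QuotientAddGroup.mk_zsmul, ← QuotientAddGroup.mk_add]
    congr 1
    ext <;> simp [mul_comm]
  rw [h, xgen, xgen, QuotientAddGroup.eq, ← mem_Lrel_iff]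
  simp only [Prod.neg_mk, Prod.mk_add_mk, neg_add_eq_sub]

/-- Every element of `𝕃(2,2,n)` has a unique normal form
`x = l₁ x₁ + l₂ x₂ + l₃ x₃ + l c` with `0 ≤ l₁ < 2`, `0 ≤ l₂ < 2`, `0 ≤ l₃ < n`,
where `c = 2 x₁` is the canonical element. -/
theorem stmt0 (n : ℤ) (hn : 2 ≤ n) (x : Lgrp n) :
    ∃! q : ℤ × ℤ × ℤ × ℤ,
      (0 ≤ q.1 ∧ q.1 < 2) ∧ (0 ≤ q.2.1 ∧ q.2.1 < 2) ∧ (0 ≤ q.2.2.1 ∧ q.2.2.1 < n) ∧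
      x = q.1 • xgen n (1, 0, 0) + q.2.1 • xgen n (0, 1, 0) + q.2.2.1 • xgen n (0, 0, 1)
          + q.2.2.2 • ((2 : ℤ) • xgen n (1, 0, 0)) := by
  obtain ⟨⟨a, b, c⟩, rfl⟩ := QuotientAddGroup.mk_surjective x
  change ∃! q : ℤ × ℤ × ℤ × ℤ, _ ∧ _ ∧ _ ∧ xgen n (a, b, c) = _
  simp only [xgen_eq_normal_form_iff]
  have hn0 : 0 < n := by linarith
  have ha := Int.emod_add_mul_ediv a 2
  have hb := Int.emod_add_mul_ediv b 2
  have hc := Int.emod_add_mul_ediv c n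
  refine ⟨(a % 2, b % 2, c % n, a / 2 + b / 2 + c / n), ?_, ?_⟩
  · refine ⟨by dsimp only; omega, by dsimp only; omega,
      ⟨Int.emod_nonneg c hn0.ne', Int.emod_lt_of_pos c hn0⟩, b / 2, c / n, ?_, ?_, ?_⟩ <;>
      dsimp only <;> linarith
  · rintro ⟨l₁, l₂, l₃, l⟩ ⟨h₁, h₂, h₃, s, t, e₁, e₂, e₃⟩
    dsimp only at h₁ h₂ h₃ e₁ e₂ e₃
    obtain ⟨ht, hl₃⟩ := (Int.ediv_emod_unique (a := c) (r := l₃) (q := t) hn0).2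
      ⟨by linarith, h₃⟩
    simp only [Prod.mk.injEq]
    refine ⟨?_, ?_, hl₃.symm, ?_⟩ <;> omega
end

section
/- Let x ∈ 𝕃 = 𝕃(2,2,n) be written in normal form x = l₁·x₁ + l₂·x₂ + l₃·x₃ + l·c with 0 ≤ l₁ < 2, 0 ≤ l₂ < 2, 0 ≤ l₃ < n. Then x lies in the additive submonoid of 𝕃 generated by x₁, x₂, x₃ (equivalently, x = a·x₁ + b·x₂ + d·x₃ for some natural numbers a, b, d) if and only if l ≥ 0. -/
/-- Congruence modulo `Lrel n` in coordinates. -/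
theorem xgen_eq_iff (n : ℤ) (v w : ℤ × ℤ × ℤ) :
    xgen n v = xgen n w ↔ ∃ p q : ℤ,
      w.1 = v.1 + 2 * p + 2 * q ∧ w.2.1 = v.2.1 - 2 * p ∧ w.2.2 = v.2.2 - q * n := by
  unfold xgen
  rw [QuotientAddGroup.eq, Lrel, AddSubgroup.mem_closure_pair]
  refine exists₂_congr fun p q => ?_
  simp only [Prod.ext_iff, Prod.smul_mk, Prod.mk_add_mk, Prod.fst_add, Prod.snd_add,
    Prod.fst_neg, Prod.snd_neg, smul_eq_mul]
  constructor <;> rintro ⟨h, h', h''⟩ <;> refine ⟨?_, ?_, ?_⟩ <;> linarith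

theorem xgen_eq_sum_zsmul (n a b d : ℤ) :
    xgen n (a, b, d) = a • xgen n (1, 0, 0) + b • xgen n (0, 1, 0) + d • xgen n (0, 0, 1) := by
  simp only [xgen, ← QuotientAddGroup.mk_zsmul, ← QuotientAddGroup.mk_add]
  simp

/-- An element `x ∈ 𝕃(2,2,n)` written in normal form
`x = l₁ x₁ + l₂ x₂ + l₃ x₃ + l c` (with `0 ≤ l₁, l₂ < 2`, `0 ≤ l₃ < n`, `c = 2x₁`)
lies in the additive submonoid generated by `x₁, x₂, x₃`
(i.e. `x = a x₁ + b x₂ + d x₃` for natural numbers `a, b, d`) iff `l ≥ 0`. -/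
theorem stmt1 (n : ℤ) (hn : 2 ≤ n) (x : Lgrp n) (l₁ l₂ l₃ l : ℤ)
    (h₁ : 0 ≤ l₁ ∧ l₁ < 2) (h₂ : 0 ≤ l₂ ∧ l₂ < 2) (h₃ : 0 ≤ l₃ ∧ l₃ < n)
    (hx : x = l₁ • xgen n (1, 0, 0) + l₂ • xgen n (0, 1, 0) + l₃ • xgen n (0, 0, 1)
        + l • ((2 : ℤ) • xgen n (1, 0, 0))) :
    (∃ a b d : ℕ, x = a • xgen n (1, 0, 0) + b • xgen n (0, 1, 0) + d • xgen n (0, 0, 1))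
      ↔ 0 ≤ l := by
  have hx' : x = xgen n (l₁ + 2 * l, l₂, l₃) := by
    rw [hx, xgen_eq_sum_zsmul n (l₁ + 2 * l), add_zsmul, mul_comm 2 l, mul_zsmul]
    abel
  constructor
  · rintro ⟨a, b, d, h⟩
    simp only [← natCast_zsmul] at h
    rw [← xgen_eq_sum_zsmul, hx', xgen_eq_iff] at h
    obtain ⟨p, q, ha, hb, hd⟩ := h
    dsimp only at ha hb hd
    have hp : p ≤ 0 := by omega
    have hq : q ≤ 0 := by
      by_contra! hq
      nlinarith
    omega
  · intro hl
    refine ⟨(l₁ + 2 * l).toNat, l₂.toNat, l₃.toNat, ?_⟩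
    simp only [← natCast_zsmul]
    rw [← xgen_eq_sum_zsmul, hx', Int.toNat_of_nonneg (by omega), Int.toNat_of_nonneg h₂.1,
      Int.toNat_of_nonneg h₃.1]
end

section
/- The group G is isomorphic to the infinite dihedral group, i.e. to the dihedral group DihedralGroup 0 (the group generated by a rotation r of infinite order and a reflection s with s² = 1 and s·r·s = r⁻¹). -/
/-- The infinite strip `S̃ = {(x,y) ∈ ℝ² : 0 ≤ y ≤ 1}`. -/
abbrev Strip := {p : ℝ × ℝ // 0 ≤ p.2 ∧ p.2 ≤ 1}

/-- The translation `σₙ : (x,y) ↦ (x+n, y)` of the strip. -/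
def sigmaN (n : ℤ) : Equiv.Perm Strip where
  toFun p := ⟨(p.1.1 + n, p.1.2), p.2⟩
  invFun p := ⟨(p.1.1 - n, p.1.2), p.2⟩
  left_inv p := Subtype.ext (by obtain ⟨⟨x, y⟩, h⟩ := p; simp)
  right_inv p := Subtype.ext (by obtain ⟨⟨x, y⟩, h⟩ := p; simp)

/-- The point reflection `θ : (x,y) ↦ (−x, 1−y)` of the strip about `(0, 1/2)`. -/
def thetaPerm : Equiv.Perm Strip where
  toFun p := ⟨(-p.1.1, 1 - p.1.2),
    show (0:ℝ) ≤ 1 - p.1.2 from by have := p.2.2; linarith,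
    show (1:ℝ) - p.1.2 ≤ 1 from by have := p.2.1; linarith⟩
  invFun p := ⟨(-p.1.1, 1 - p.1.2),
    show (0:ℝ) ≤ 1 - p.1.2 from by have := p.2.2; linarith,
    show (1:ℝ) - p.1.2 ≤ 1 from by have := p.2.1; linarith⟩
  left_inv p := Subtype.ext (by obtain ⟨⟨x, y⟩, h⟩ := p; simp)
  right_inv p := Subtype.ext (by obtain ⟨⟨x, y⟩, h⟩ := p; simp)

/-- The homomorphism from the infinite dihedral group determined by an element `a` and an
involution `b` inverting `a` under conjugation. -/
def DihedralGroup.liftZero {H : Type*} [Group H] (a b : H) (hb : b * b = 1)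
    (hab : b * a * b = a⁻¹) : DihedralGroup 0 →* H :=
  have hconj (k : ℤ) : a ^ k * b = b * a ^ (-k) := by
    have hsemi : SemiconjBy b a⁻¹ a := by
      rw [SemiconjBy, ← hab]
      simp only [← mul_assoc, hb, one_mul]
    rw [← inv_zpow']
    exact (hsemi.zpow_right k).symm
  MonoidHom.mk'
    (fun
      | .r i => a ^ (show ℤ from i)
      | .sr i => b * a ^ (show ℤ from i))
    (by
      rintro ((i : ℤ) | (i : ℤ)) ((j : ℤ) | (j : ℤ))
      · exact zpow_add a i j
      · change b * a ^ (j - i : ℤ) = a ^ i * (b * a ^ j)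
        rw [← mul_assoc, hconj, mul_assoc, ← zpow_add, sub_eq_neg_add]
      · change b * a ^ (i + j : ℤ) = b * a ^ i * a ^ j
        rw [mul_assoc, ← zpow_add]
      · change a ^ (j - i : ℤ) = b * a ^ i * (b * a ^ j)
        rw [mul_assoc, ← mul_assoc (a ^ _) b, hconj, ← mul_assoc, ← mul_assoc, hb, one_mul,
          ← zpow_add, sub_eq_neg_add])

theorem DihedralGroup.liftZero_r {H : Type*} [Group H] (a b : H) (hb : b * b = 1)
    (hab : b * a * b = a⁻¹) (i : ℤ) : liftZero a b hb hab (.r i) = a ^ i := rfl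

theorem DihedralGroup.liftZero_sr {H : Type*} [Group H] (a b : H) (hb : b * b = 1)
    (hab : b * a * b = a⁻¹) (i : ℤ) : liftZero a b hb hab (.sr i) = b * a ^ i := rfl

theorem DihedralGroup.range_liftZero {H : Type*} [Group H] (a b : H) (hb : b * b = 1)
    (hab : b * a * b = a⁻¹) : (liftZero a b hb hab).range = Subgroup.closure {a, b} := by
  have ha_mem : a ∈ Subgroup.closure {a, b} := Subgroup.subset_closure (by simp)
  have hb_mem : b ∈ Subgroup.closure {a, b} := Subgroup.subset_closure (by simp)
  apply le_antisymm
  · rintro _ ⟨i | i, rfl⟩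
    · exact zpow_mem ha_mem _
    · exact mul_mem hb_mem (zpow_mem ha_mem _)
  · rw [Subgroup.closure_le]
    rintro _ (rfl | rfl)
    · exact ⟨.r (1 : ℤ), by rw [liftZero_r, zpow_one]⟩
    · exact ⟨.sr (0 : ℤ), by rw [liftZero_sr, zpow_zero, mul_one]⟩

theorem thetaPerm_mul_self : thetaPerm * thetaPerm = 1 := by
  ext p <;> simp [thetaPerm]

theorem thetaPerm_mul_sigmaN_mul_thetaPerm (n : ℤ) :
    thetaPerm * sigmaN n * thetaPerm = (sigmaN n)⁻¹ := by
  rw [eq_inv_iff_mul_eq_one]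
  ext p <;> simp [thetaPerm, sigmaN]

theorem sigmaN_mul_sigmaN (m n : ℤ) : sigmaN m * sigmaN n = sigmaN (m + n) := by
  ext p
  · simp [sigmaN]
    ring
  · simp [sigmaN]

/-- Translations of the strip by integers, as a homomorphism. -/
def sigmaHom : Multiplicative ℤ →* Equiv.Perm Strip :=
  MonoidHom.mk' (fun m => sigmaN m.toAdd) fun m n => (sigmaN_mul_sigmaN m.toAdd n.toAdd).symm

theorem sigmaN_zpow (n k : ℤ) : sigmaN n ^ k = sigmaN (k * n) := by
  have h := map_zpow sigmaHom (Multiplicative.ofAdd n) k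
  rw [← ofAdd_zsmul, smul_eq_mul] at h
  exact h.symm

theorem liftZero_sigmaN_thetaPerm_injective {n : ℤ} (hn : n ≠ 0) :
    Function.Injective (DihedralGroup.liftZero (sigmaN n) thetaPerm thetaPerm_mul_self
      (thetaPerm_mul_sigmaN_mul_thetaPerm n)) := by
  rw [injective_iff_map_eq_one]
  rintro ((i : ℤ) | (i : ℤ)) h
  · rw [DihedralGroup.liftZero_r, sigmaN_zpow] at h
    have h0 := congrArg (fun f : Equiv.Perm Strip => (f ⟨(0, 0), by simp⟩).1.1) h
    have hi : i = 0 := by simpa [sigmaN, hn] using h0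
    rw [hi]
    rfl
  · rw [DihedralGroup.liftZero_sr, sigmaN_zpow] at h
    have h0 := congrArg (fun f : Equiv.Perm Strip => (f ⟨(0, 0), by simp⟩).1.2) h
    simp [sigmaN, thetaPerm] at h0

/-- The group `G` generated by `σₙ` and `θ` is isomorphic to the infinite
dihedral group `DihedralGroup 0`. -/
theorem stmt4 (n : ℤ) (hn : 2 ≤ n) :
    Nonempty (↥(Subgroup.closure {sigmaN n, thetaPerm}) ≃* DihedralGroup 0) := by
  rw [← DihedralGroup.range_liftZero _ _ thetaPerm_mul_self (thetaPerm_mul_sigmaN_mul_thetaPerm n)]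
  exact ⟨(MonoidHom.ofInjective (liftZero_sigmaN_thetaPerm_injective (by lia))).symm⟩
end

section
/- Every H-orbit in ℤ × ℤ contains a pair (i,j) with −n < i+j ≤ n. Moreover, if (i,j) and (s,t) both satisfy −n < i+j ≤ n and −n < s+t ≤ n and lie in the same H-orbit, then (s,t) = (i,j) or (s,t) = (−j,−i). -/
/-- The translation `σₙ : (i,j) ↦ (i+n, j+n)` on segments (pairs of integers). -/
def segSigma (n : ℤ) : Equiv.Perm (ℤ × ℤ) where
  toFun p := (p.1 + n, p.2 + n)
  invFun p := (p.1 - n, p.2 - n)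
  left_inv p := by obtain ⟨i, j⟩ := p; simp
  right_inv p := by obtain ⟨i, j⟩ := p; simp

/-- The reflection `θ : (i,j) ↦ (−j, −i)` on segments. -/
def segTheta : Equiv.Perm (ℤ × ℤ) where
  toFun p := (-p.2, -p.1)
  invFun p := (-p.2, -p.1)
  left_inv p := by obtain ⟨i, j⟩ := p; simp
  right_inv p := by obtain ⟨i, j⟩ := p; simp

/-- The group `H` of symmetries of the set of segments, generated by `σₙ` and `θ`. -/
def segH (n : ℤ) : Subgroup (Equiv.Perm (ℤ × ℤ)) :=
  Subgroup.closure {segSigma n, segTheta}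

theorem segSigma_zpow_apply (n k : ℤ) (p : ℤ × ℤ) :
    (segSigma n ^ k) p = (p.1 + k * n, p.2 + k * n) := by
  induction k generalizing p with
  | zero => simp
  | succ k ih =>
    rw [zpow_add_one, Equiv.Perm.mul_apply, ih]
    simp only [segSigma, Equiv.coe_fn_mk, Prod.mk.injEq]
    constructor <;> ring
  | pred k ih =>
    rw [zpow_sub_one, Equiv.Perm.mul_apply, ih]
    change (p.1 - n + _, p.2 - n + _) = _
    rw [Prod.mk.injEq]
    constructor <;> ring

/-- Every element of `H` is a translation by a multiple of `n`, possibly composed with `θ`. -/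
theorem segH_apply_eq {n : ℤ} {h : Equiv.Perm (ℤ × ℤ)} (hh : h ∈ segH n) :
    (∃ k : ℤ, ∀ i j, h (i, j) = (i + k * n, j + k * n)) ∨
      ∃ k : ℤ, ∀ i j, h (i, j) = (-j + k * n, -i + k * n) := by
  induction hh using Subgroup.closure_induction with
  | mem x hx =>
    rcases hx with rfl | rfl
    · exact Or.inl ⟨1, fun i j => by simp [segSigma]⟩
    · exact Or.inr ⟨0, fun i j => by simp [segTheta]⟩
  | one => exact Or.inl ⟨0, fun i j => by simp⟩
  | mul x y _ _ hx hy =>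
    rcases hx with ⟨k, hk⟩ | ⟨k, hk⟩ <;> rcases hy with ⟨l, hl⟩ | ⟨l, hl⟩
    · refine Or.inl ⟨k + l, fun i j => ?_⟩
      rw [Equiv.Perm.mul_apply, hl, hk, Prod.mk.injEq]
      constructor <;> ring
    · refine Or.inr ⟨k + l, fun i j => ?_⟩
      rw [Equiv.Perm.mul_apply, hl, hk, Prod.mk.injEq]
      constructor <;> ring
    · refine Or.inr ⟨k - l, fun i j => ?_⟩
      rw [Equiv.Perm.mul_apply, hl, hk, Prod.mk.injEq]
      constructor <;> ring
    · refine Or.inl ⟨k - l, fun i j => ?_⟩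
      rw [Equiv.Perm.mul_apply, hl, hk, Prod.mk.injEq]
      constructor <;> ring
  | inv x _ hx =>
    rcases hx with ⟨k, hk⟩ | ⟨k, hk⟩
    · refine Or.inl ⟨-k, fun i j => ?_⟩
      rw [Equiv.Perm.inv_eq_iff_eq, hk, Prod.mk.injEq]
      constructor <;> ring
    · refine Or.inr ⟨k, fun i j => ?_⟩
      rw [Equiv.Perm.inv_eq_iff_eq, hk, Prod.mk.injEq]
      constructor <;> ring

/-- Every `H`-orbit of segments contains a pair `(i,j)` with `−n < i+j ≤ n`; and two
pairs with sums in `(−n, n]` in the same `H`-orbit satisfy `(s,t) = (i,j)` or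
`(s,t) = (−j,−i)`. -/
theorem stmt6 (n : ℤ) (hn : 2 ≤ n) :
    (∀ i j : ℤ, ∃ i' j' : ℤ, -n < i' + j' ∧ i' + j' ≤ n ∧
        ∃ h ∈ segH n, h (i, j) = (i', j')) ∧
    (∀ i j s t : ℤ, -n < i + j → i + j ≤ n → -n < s + t → s + t ≤ n →
        (∃ h ∈ segH n, h (i, j) = (s, t)) → (s, t) = (i, j) ∨ (s, t) = (-j, -i)) := by
  refine ⟨fun i j => ?_, fun i j s t h₁ h₂ h₃ h₄ ⟨h, hh, hst⟩ => ?_⟩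
  · have hpos : 0 < 2 * n := by linarith
    have hdiv := Int.emod_add_mul_ediv (i + j + n - 1) (2 * n)
    have hnonneg := Int.emod_nonneg (i + j + n - 1) hpos.ne'
    have hlt := Int.emod_lt_of_pos (i + j + n - 1) hpos
    set q := (i + j + n - 1) / (2 * n)
    refine ⟨i + -q * n, j + -q * n, by linarith, by linarith, segSigma n ^ (-q),
      zpow_mem (Subgroup.subset_closure (by simp)) _, segSigma_zpow_apply n _ _⟩
  · rcases segH_apply_eq hh with ⟨k, hk⟩ | ⟨k, hk⟩ <;>
      obtain ⟨rfl, rfl⟩ := Prod.mk.inj ((hk i j).symm.trans hst)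
    · have hk_lt : k < 1 := by nlinarith
      have hk_gt : -1 < k := by nlinarith
      obtain rfl : k = 0 := by omega
      simp
    · have hk_lt : k < 2 := by nlinarith
      have hk_gt : -1 < k := by nlinarith
      obtain rfl | rfl : k = 0 ∨ k = 1 := by omega
      · simp
      · left
        rw [Prod.mk.injEq]
        constructor <;> linarith
end

section
/- Define permutations τ and ρ of ℤ × Fin(n+1) by τ(s,i) = (s+1, i) and ρ(s,i) = (s+i, n−i) (with i ∈ {0,1,…,n}; in the paper's 1-indexed notation ρ sends (s,i) to (s+i−1, n−i+2)). Then ρ² = τⁿ and τ∘ρ = ρ∘τ, and the group homomorphism from the presented abelian group P = ⟨α, β | 2α = nβ⟩ to the permutation group of ℤ × Fin(n+1) determined by α ↦ ρ and β ↦ τ is injective; consequently, the subgroup generated by τ and ρ is isomorphic to P. -/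
/-- The abelian group `P = ⟨α, β ∣ 2α = nβ⟩`, i.e. `ℤ²` modulo the subgroup
generated by `(2, −n)`; `α` and `β` are the images of `(1,0)` and `(0,1)`. -/
abbrev Pgrp (n : ℤ) := (ℤ × ℤ) ⧸ (AddSubgroup.closure {((2 : ℤ), -n)})

/-- The translation `τ : (s,i) ↦ (s+1, i)` of `ℤ × Fin (n+1)`. -/
def tauPerm (n : ℕ) : Equiv.Perm (ℤ × Fin (n + 1)) where
  toFun p := (p.1 + 1, p.2)
  invFun p := (p.1 - 1, p.2)
  left_inv p := by obtain ⟨s, i⟩ := p; simp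
  right_inv p := by obtain ⟨s, i⟩ := p; simp

/-- The half-turn `ρ : (s,i) ↦ (s+i, n−i)` of `ℤ × Fin (n+1)` (0-indexed version of
the paper's `(s,i) ↦ (s+i−1, n−i+2)`). -/
def rhoPerm (n : ℕ) : Equiv.Perm (ℤ × Fin (n + 1)) where
  toFun p := (p.1 + p.2.val, p.2.rev)
  invFun p := (p.1 - p.2.rev.val, p.2.rev)
  left_inv p := by obtain ⟨s, i⟩ := p; simp
  right_inv p := by obtain ⟨s, i⟩ := p; simp

/-- A commuting pair `g, h` in a group determines the homomorphism
`(a, b) ↦ g ^ a * h ^ b` on `ℤ × ℤ`. -/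
def Commute.zpowPairHom {G : Type*} [Group G] {g h : G} (hgh : Commute g h) :
    ℤ × ℤ →+ Additive G :=
  AddMonoidHom.mk' (fun p => Additive.ofMul (g ^ p.1 * h ^ p.2)) fun p q => by
    rw [← ofMul_mul, Prod.fst_add, Prod.snd_add, zpow_add, zpow_add,
      (hgh.zpow_zpow q.1 p.2).mul_mul_mul_comm]

theorem tauPerm_zpow_apply (n : ℕ) (k : ℤ) (p : ℤ × Fin (n + 1)) :
    (tauPerm n ^ k) p = (p.1 + k, p.2) := by
  induction k with
  | zero => simp
  | succ k ih =>
    rw [add_comm (k : ℤ), zpow_add, Equiv.Perm.mul_apply, ih]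
    simp [tauPerm, add_assoc, add_comm]
  | pred k ih =>
    rw [sub_eq_neg_add, zpow_add, Equiv.Perm.mul_apply, ih, zpow_neg_one, Equiv.Perm.inv_def]
    simp only [tauPerm, Equiv.coe_fn_symm_mk, Prod.mk.injEq, and_true]
    ring

theorem rhoPerm_sq (n : ℕ) : rhoPerm n ^ 2 = tauPerm n ^ n := by
  ext1 ⟨s, i⟩
  rw [← zpow_natCast (tauPerm n), tauPerm_zpow_apply, sq, Equiv.Perm.mul_apply]
  simp only [rhoPerm, Equiv.coe_fn_mk, Fin.rev_rev, Fin.val_rev, Prod.mk.injEq, and_true]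
  omega

theorem commute_rhoPerm_tauPerm (n : ℕ) : Commute (rhoPerm n) (tauPerm n) := by
  ext1 ⟨s, i⟩
  simp [rhoPerm, tauPerm, add_right_comm]

theorem ker_zpowPairHom_rhoPerm_tauPerm {n : ℕ} (hn : n ≠ 0) :
    (commute_rhoPerm_tauPerm n).zpowPairHom.ker =
      AddSubgroup.closure {((2 : ℤ), -(n : ℤ))} := by
  have rho_zpow (c : ℤ) : rhoPerm n ^ (2 * c) = tauPerm n ^ (n * c) := by
    rw [zpow_mul, zpow_mul, zpow_natCast, ← rhoPerm_sq]
    rfl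
  refine le_antisymm ?_ ?_
  · rintro ⟨a, b⟩ h
    replace h : rhoPerm n ^ a * tauPerm n ^ b = 1 := h
    rw [AddSubgroup.mem_closure_singleton]
    obtain ⟨c, rfl | rfl⟩ := Int.even_or_odd' a
    · rw [rho_zpow, ← zpow_add] at h
      have h0 := congrArg Prod.fst (Equiv.congr_fun h (0, 0))
      simp only [tauPerm_zpow_apply, Equiv.Perm.one_apply, zero_add] at h0
      refine ⟨c, ?_⟩
      simp only [Prod.smul_mk, smul_eq_mul, Prod.mk.injEq]
      constructor <;> linarith
    · rw [add_comm (2 * c), zpow_add, zpow_one, rho_zpow, mul_assoc, ← zpow_add] at h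
      have h0 := congrArg Prod.snd (Equiv.congr_fun h (0, 0))
      rw [Equiv.Perm.mul_apply, tauPerm_zpow_apply] at h0
      exact absurd (congrArg Fin.val h0) (by simpa [rhoPerm] using hn)
  · rw [AddSubgroup.closure_le, Set.singleton_subset_iff]
    change rhoPerm n ^ (2 : ℤ) * tauPerm n ^ (-(n : ℤ)) = 1
    rw [zpow_neg, mul_inv_eq_one, zpow_natCast, ← rhoPerm_sq]
    rfl

/-- The homomorphism `P → Perm (ℤ × Fin (n+1))` with `α ↦ ρ` and `β ↦ τ`. -/
def Pgrp.toPerm {n : ℕ} (hn : n ≠ 0) :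
    Pgrp (n : ℤ) →+ Additive (Equiv.Perm (ℤ × Fin (n + 1))) :=
  QuotientAddGroup.lift _ (commute_rhoPerm_tauPerm n).zpowPairHom
    (ker_zpowPairHom_rhoPerm_tauPerm hn).ge

theorem Pgrp.toPerm_mk {n : ℕ} (hn : n ≠ 0) (p : ℤ × ℤ) :
    Pgrp.toPerm hn (QuotientAddGroup.mk p) =
      Additive.ofMul (rhoPerm n ^ p.1 * tauPerm n ^ p.2) :=
  rfl

theorem Pgrp.toPerm_injective {n : ℕ} (hn : n ≠ 0) : Function.Injective (Pgrp.toPerm hn) := by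
  rw [injective_iff_map_eq_zero]
  intro x
  induction x using QuotientAddGroup.induction_on with
  | H p =>
    intro h
    rw [QuotientAddGroup.eq_zero_iff, ← ker_zpowPairHom_rhoPerm_tauPerm hn]
    exact h

theorem Pgrp.range_toPerm {n : ℕ} (hn : n ≠ 0) :
    (AddMonoidHom.toMultiplicativeLeft (Pgrp.toPerm hn)).range =
      Subgroup.closure {tauPerm n, rhoPerm n} := by
  refine le_antisymm ?_ ?_
  · rintro _ ⟨x, rfl⟩
    induction x using QuotientAddGroup.induction_on with
    | H p =>
      exact mul_mem (zpow_mem (Subgroup.subset_closure (by simp)) _)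
        (zpow_mem (Subgroup.subset_closure (by simp)) _)
  · rw [Subgroup.closure_le, Set.insert_subset_iff, Set.singleton_subset_iff]
    refine ⟨⟨Multiplicative.ofAdd (QuotientAddGroup.mk (0, 1)), ?_⟩,
      ⟨Multiplicative.ofAdd (QuotientAddGroup.mk (1, 0)), ?_⟩⟩ <;>
    simp [Pgrp.toPerm_mk]

/-- `ρ² = τⁿ`, `τρ = ρτ`, and the homomorphism `P → Perm (ℤ × Fin (n+1))` determined
by `α ↦ ρ`, `β ↦ τ` is injective; consequently the subgroup generated by `τ` and `ρ`
is isomorphic to `P`. -/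
theorem stmt10 (n : ℕ) (hn : 2 ≤ n) :
    rhoPerm n ^ 2 = tauPerm n ^ n ∧
    tauPerm n * rhoPerm n = rhoPerm n * tauPerm n ∧
    (∃ f : Pgrp (n : ℤ) →+ Additive (Equiv.Perm (ℤ × Fin (n + 1))),
      f (QuotientAddGroup.mk (1, 0)) = Additive.ofMul (rhoPerm n) ∧
      f (QuotientAddGroup.mk (0, 1)) = Additive.ofMul (tauPerm n) ∧
      Function.Injective f) ∧
    Nonempty (↥(Subgroup.closure {tauPerm n, rhoPerm n}) ≃* Multiplicative (Pgrp (n : ℤ))) := by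
  have hn0 : n ≠ 0 := by omega
  refine ⟨rhoPerm_sq n, (commute_rhoPerm_tauPerm n).symm.eq,
    ⟨Pgrp.toPerm hn0, ?_, ?_, Pgrp.toPerm_injective hn0⟩, ⟨?_⟩⟩
  · simp [Pgrp.toPerm_mk]
  · simp [Pgrp.toPerm_mk]
  · exact ((MonoidHom.ofInjective
      (f := AddMonoidHom.toMultiplicativeLeft (Pgrp.toPerm hn0))
      (Pgrp.toPerm_injective hn0)).trans
        (MulEquiv.subgroupCongr (Pgrp.range_toPerm hn0))).symm
end

section
/- For pairs (i,j), (s,t) ∈ ℤ × ℤ define N((i,j),(s,t)) to be the sum of the cardinalities of the two finite sets {m ∈ ℤ : s+m·n > i and t+m·n < j} and {m ∈ ℤ : −t+m·n > i and −s+m·n < j} (this is the number of positive intersections of the segment [i,j] with the segments in the H-orbit of [s,t]). Then both sets are finite, and N is invariant under the H-action in each argument: for every h ∈ H, N(h·(i,j), (s,t)) = N((i,j), (s,t)) = N((i,j), h·(s,t)). -/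
/-- The number of positive intersections of the segment `[i,j]` (first argument) with
the segments in the `H`-orbit of `[s,t]` (second argument). -/
noncomputable def posInt (n : ℤ) (p q : ℤ × ℤ) : ℕ :=
  {m : ℤ | q.1 + m * n > p.1 ∧ q.2 + m * n < p.2}.ncard +
  {m : ℤ | -q.2 + m * n > p.1 ∧ -q.1 + m * n < p.2}.ncard

/-- The integers `m` for which the translate of `q` by `m * n` crosses `p` positively. -/
def posShifts (n : ℤ) (p q : ℤ × ℤ) : Set ℤ :=
  {m : ℤ | q.1 + m * n > p.1 ∧ q.2 + m * n < p.2}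

theorem posShifts_finite {n : ℤ} (hn : n ≠ 0) (p q : ℤ × ℤ) : (posShifts n p q).Finite := by
  refine ((Set.finite_Ioo (p.1 - q.1) (p.2 - q.2)).preimage
    (mul_left_injective₀ hn).injOn).subset fun m hm => ?_
  obtain ⟨h₁, h₂⟩ := hm
  constructor <;> dsimp only <;> linarith

theorem posInt_eq_add_ncard (n : ℤ) (p q : ℤ × ℤ) :
    posInt n p q = (posShifts n p q).ncard + (posShifts n p (segTheta q)).ncard := rfl

theorem segTheta_segTheta (p : ℤ × ℤ) : segTheta (segTheta p) = p :=
  segTheta.left_inv p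

theorem ncard_preimage_equiv {α β : Type*} (e : α ≃ β) (s : Set β) :
    (e ⁻¹' s).ncard = s.ncard :=
  Set.ncard_preimage_of_injective_subset_range e.injective (by simp [e.range_eq_univ])

theorem ncard_posShifts_add_right (n k : ℤ) (p q : ℤ × ℤ) :
    (posShifts n p (q.1 + k * n, q.2 + k * n)).ncard = (posShifts n p q).ncard := by
  rw [← ncard_preimage_equiv (Equiv.addRight k) (posShifts n p q)]
  congr 1
  ext m
  simp only [posShifts, Set.mem_preimage, Set.mem_ofPred_eq, Equiv.coe_addRight]
  ring_nf

theorem ncard_posShifts_add_left (n k : ℤ) (p q : ℤ × ℤ) :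
    (posShifts n (p.1 + k * n, p.2 + k * n) q).ncard = (posShifts n p q).ncard := by
  rw [← ncard_posShifts_add_right n (-k) p q]
  congr 1
  ext m
  simp only [posShifts, Set.mem_ofPred_eq]
  constructor <;> rintro ⟨h₁, h₂⟩ <;> constructor <;> linarith

theorem ncard_posShifts_segTheta_left (n : ℤ) (p q : ℤ × ℤ) :
    (posShifts n (segTheta p) q).ncard = (posShifts n p (segTheta q)).ncard := by
  rw [← ncard_preimage_equiv (Equiv.neg ℤ) (posShifts n p (segTheta q))]
  congr 1
  ext m
  simp only [posShifts, segTheta, Equiv.coe_fn_mk, Set.mem_preimage, Set.mem_ofPred_eq,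
    Equiv.neg_apply]
  constructor <;> rintro ⟨h₁, h₂⟩ <;> constructor <;> linarith

theorem posInt_segSigma_left (n : ℤ) (p q : ℤ × ℤ) :
    posInt n (segSigma n p) q = posInt n p q := by
  have h : segSigma n p = (p.1 + 1 * n, p.2 + 1 * n) := by simp [segSigma]
  rw [h, posInt_eq_add_ncard, posInt_eq_add_ncard, ncard_posShifts_add_left,
    ncard_posShifts_add_left]

theorem posInt_segTheta_right (n : ℤ) (p q : ℤ × ℤ) :
    posInt n p (segTheta q) = posInt n p q := by
  rw [posInt_eq_add_ncard, posInt_eq_add_ncard, segTheta_segTheta, add_comm]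

theorem posInt_segTheta_left (n : ℤ) (p q : ℤ × ℤ) :
    posInt n (segTheta p) q = posInt n p q := by
  rw [← posInt_segTheta_right n p q, posInt_eq_add_ncard, posInt_eq_add_ncard,
    ncard_posShifts_segTheta_left, ncard_posShifts_segTheta_left]

theorem posInt_segSigma_right (n : ℤ) (p q : ℤ × ℤ) :
    posInt n p (segSigma n q) = posInt n p q := by
  have h : segSigma n q = (q.1 + 1 * n, q.2 + 1 * n) := by simp [segSigma]
  have h' : segTheta (segSigma n q) =
      ((segTheta q).1 + -1 * n, (segTheta q).2 + -1 * n) := by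
    simp [segSigma, segTheta, add_comm]
  rw [posInt_eq_add_ncard, posInt_eq_add_ncard, h', h, ncard_posShifts_add_right,
    ncard_posShifts_add_right]

theorem posInt_apply_of_mem_segH {n : ℤ} {h : Equiv.Perm (ℤ × ℤ)} (hh : h ∈ segH n) :
    ∀ p q, posInt n (h p) q = posInt n p q ∧ posInt n p (h q) = posInt n p q := by
  induction hh using Subgroup.closure_induction with
  | mem g hg =>
    rcases hg with rfl | rfl
    · exact fun p q => ⟨posInt_segSigma_left n p q, posInt_segSigma_right n p q⟩
    · exact fun p q => ⟨posInt_segTheta_left n p q, posInt_segTheta_right n p q⟩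
  | one => exact fun p q => ⟨rfl, rfl⟩
  | mul g k _ _ hg hk =>
    intro p q
    simp only [Equiv.Perm.mul_apply]
    exact ⟨((hg _ _).1).trans (hk _ _).1, ((hg _ _).2).trans (hk _ _).2⟩
  | inv g _ hg =>
    intro p q
    have h₁ := (hg (g⁻¹ p) q).1
    have h₂ := (hg p (g⁻¹ q)).2
    rw [← Equiv.Perm.mul_apply, mul_inv_cancel, Equiv.Perm.one_apply] at h₁ h₂
    exact ⟨h₁.symm, h₂.symm⟩

/-- The two defining sets of `N((i,j),(s,t)) = posInt` are finite, and `N` is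
invariant under the `H`-action in each argument. -/
theorem stmt15 (n : ℤ) (hn : 2 ≤ n) (i j s t : ℤ) :
    {m : ℤ | s + m * n > i ∧ t + m * n < j}.Finite ∧
    {m : ℤ | -t + m * n > i ∧ -s + m * n < j}.Finite ∧
    ∀ h ∈ segH n, posInt n (h (i, j)) (s, t) = posInt n (i, j) (s, t) ∧
        posInt n (i, j) (h (s, t)) = posInt n (i, j) (s, t) := by
  have hn0 : n ≠ 0 := by omega
  exact ⟨posShifts_finite hn0 (i, j) (s, t), posShifts_finite hn0 (i, j) (-t, -s),
    fun h hh => posInt_apply_of_mem_segH hh (i, j) (s, t)⟩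
end
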